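/- Let g be a finite-dimensional real Lie algebra that is the direct sum of two ideals k₁ and k₂ with [k₁, k₂] = 0, and let ψ : k₁ → k₂ be a Lie algebra isomorphism. Set k = {X + ψ(X) : X ∈ k₁} and p = {X − ψ(X) : X ∈ k₁}. Then k is a Lie subalgebra of g, g = k ⊕ p as vector spaces, and the map (a, b) ↦ (a + ψ(a)) + (b − ψ(b)) is a Lie algebra isomorphism from the semidirect product k₁ ⋉ k₁ — the vector space k₁ × k₁ with bracket [(a,b),(a',b')] = ([a,a'], [a,b'] + [b,a']) — onto (g, [·,·]₀^{k,p}). -/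

import Mathlib

open Submodule

variable {g : Type*} [LieRing g] [LieAlgebra ℝ g]

/-- Projection onto `k` along `p`, viewed as a map `g →ₗ[ℝ] g`. -/
noncomputable def prSub (k p : Submodule ℝ g) (h : IsCompl k p) : g →ₗ[ℝ] g :=
  k.subtype ∘ₗ (Submodule.linearProjOfIsCompl k p h)

/-- The contracted (Inönü–Wigner) bracket `[·,·]₀^{k,p}` associated to `g = k ⊕ p`. -/
noncomputable def contractedBracket (k p : Submodule ℝ g) (h : IsCompl k p)
    (X Y : g) : g :=
  ⁅prSub k p h X, prSub k p h Y⁆ + prSub p k h.symm ⁅prSub k p h X, prSub p k h.symm Y⁆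
    + prSub p k h.symm ⁅prSub p k h.symm X, prSub k p h Y⁆

theorem prSub_add_of_mem {k p : Submodule ℝ g} (h : IsCompl k p) {u v : g}
    (hu : u ∈ k) (hv : v ∈ p) : prSub k p h (u + v) = u := by
  have hu' : k.projectionOnto p h u = ⟨u, hu⟩ := Submodule.projectionOnto_apply_left h ⟨u, hu⟩
  have hv' : k.projectionOnto p h v = 0 := Submodule.projectionOnto_apply_right h ⟨v, hv⟩
  change (k.projectionOnto p h (u + v) : g) = u
  rw [map_add, hu', hv', add_zero]

theorem contractedBracket_add_add {k p : Submodule ℝ g} (h : IsCompl k p) {u v u' v' : g}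
    (hu : u ∈ k) (hv : v ∈ p) (hu' : u' ∈ k) (hv' : v' ∈ p)
    (huv' : ⁅u, v'⁆ ∈ p) (hvu' : ⁅v, u'⁆ ∈ p) :
    contractedBracket k p h (u + v) (u' + v') = ⁅u, u'⁆ + ⁅u, v'⁆ + ⁅v, u'⁆ := by
  have hfix {w : g} (hw : w ∈ p) : prSub p k h.symm w = w := by
    simpa using prSub_add_of_mem h.symm hw k.zero_mem
  have hpr {x y : g} (hx : x ∈ k) (hy : y ∈ p) : prSub p k h.symm (x + y) = y := by
    rw [add_comm]; exact prSub_add_of_mem h.symm hy hx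
  rw [contractedBracket, prSub_add_of_mem h hu hv, prSub_add_of_mem h hu' hv',
    hpr hu hv, hpr hu' hv', hfix huv', hfix hvu']

/-- Let `g = k₁ ⊕ k₂` be a direct sum of ideals with `[k₁,k₂] = 0` and
`ψ : k₁ → k₂` a Lie algebra isomorphism.  With `k = {X + ψX}` and `p = {X − ψX}`,
the subspace `k` is a Lie subalgebra, `g = k ⊕ p`, and `(a,b) ↦ (a + ψa) + (b − ψb)` is
a Lie algebra isomorphism from the semidirect product `k₁ ⋉ k₁` (with bracket
`[(a,b),(a',b')] = ([a,a'], [a,b'] + [b,a'])`) onto `(g, [·,·]₀^{k,p})`. -/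
theorem contraction_of_diagonal_subalgebra
    (g : Type*) [LieRing g] [LieAlgebra ℝ g] [FiniteDimensional ℝ g]
    (k₁ k₂ : LieIdeal ℝ g)
    (hcompl₁₂ : IsCompl (k₁ : Submodule ℝ g) (k₂ : Submodule ℝ g))
    (hcomm : ∀ X ∈ k₁, ∀ Y ∈ k₂, ⁅X, Y⁆ = 0)
    (ψ : k₁ ≃ₗ⁅ℝ⁆ k₂)
    (k p : Submodule ℝ g)
    (hk : (k : Set g) = {z | ∃ X : k₁, z = (X : g) + (ψ X : g)})
    (hp : (p : Set g) = {z | ∃ X : k₁, z = (X : g) - (ψ X : g)}) :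
    (∀ X ∈ k, ∀ Y ∈ k, ⁅X, Y⁆ ∈ k) ∧
    ∃ hcompl : IsCompl k p,
      ∃ Φ : k₁ × k₁ → g,
        (∀ ab : k₁ × k₁, Φ ab = ((ab.1 : g) + (ψ ab.1 : g)) + ((ab.2 : g) - (ψ ab.2 : g))) ∧
        Function.Bijective Φ ∧
        (∀ x y : k₁ × k₁, Φ (x + y) = Φ x + Φ y) ∧
        (∀ (c : ℝ) (x : k₁ × k₁), Φ (c • x) = c • Φ x) ∧
        (∀ a b a' b' : k₁,
          contractedBracket k p hcompl (Φ (a, b)) (Φ (a', b'))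
            = Φ (⁅a, a'⁆, ⁅a, b'⁆ + ⁅b, a'⁆)) := by
  have hmk (z : g) : z ∈ k ↔ ∃ X : k₁, z = (X : g) + (ψ X : g) := Set.ext_iff.mp hk z
  have hmp (z : g) : z ∈ p ↔ ∃ X : k₁, z = (X : g) - (ψ X : g) := Set.ext_iff.mp hp z
  have h₁₂ (X Y : k₁) : ⁅(X : g), (ψ Y : g)⁆ = 0 := hcomm X X.2 (ψ Y) (ψ Y).2
  have h₂₁ (X Y : k₁) : ⁅(ψ X : g), (Y : g)⁆ = 0 := by rw [← lie_skew, h₁₂, neg_zero]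
  have hψ (X Y : k₁) : (ψ ⁅X, Y⁆ : g) = ⁅(ψ X : g), (ψ Y : g)⁆ := by
    rw [LieEquiv.map_lie]; rfl
  have hlie (X Y : k₁) : ((⁅X, Y⁆ : k₁) : g) = ⁅(X : g), (Y : g)⁆ := rfl
  have hkk (X Y : k₁) : ⁅(X : g) + (ψ X : g), (Y : g) + (ψ Y : g)⁆
      = ((⁅X, Y⁆ : k₁) : g) + (ψ ⁅X, Y⁆ : g) := by
    simp only [hψ, hlie, add_lie, lie_add, h₁₂, h₂₁, add_zero, zero_add]
  have hkp (X Y : k₁) : ⁅(X : g) + (ψ X : g), (Y : g) - (ψ Y : g)⁆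
      = ((⁅X, Y⁆ : k₁) : g) - (ψ ⁅X, Y⁆ : g) := by
    simp only [hψ, hlie, add_lie, lie_sub, h₁₂, h₂₁]
    abel
  have hpk (X Y : k₁) : ⁅(X : g) - (ψ X : g), (Y : g) + (ψ Y : g)⁆
      = ((⁅X, Y⁆ : k₁) : g) - (ψ ⁅X, Y⁆ : g) := by
    simp only [hψ, hlie, sub_lie, lie_add, h₁₂, h₂₁]
    abel
  have hadd (X Y : k₁) : (ψ (X + Y) : g) = (ψ X : g) + (ψ Y : g) := by
    rw [map_add]; rfl
  have hsub (X Y : k₁) : (ψ (X - Y) : g) = (ψ X : g) - (ψ Y : g) := by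
    rw [map_sub]; rfl
  have hsmul (c : ℝ) (X : k₁) : (ψ (c • X) : g) = c • (ψ X : g) := by
    rw [map_smul]; rfl
  have hzero {X Y : k₁} (hXY : (X : g) + (ψ Y : g) = 0) : X = 0 ∧ Y = 0 := by
    have hX : (X : g) = 0 := by
      refine Submodule.disjoint_def.mp hcompl₁₂.disjoint _ X.2 ?_
      rw [eq_neg_of_add_eq_zero_left hXY]
      exact Submodule.neg_mem _ (ψ Y).2
    have hY : ψ Y = 0 := Subtype.ext (by simpa [hX] using hXY)
    exact ⟨Subtype.ext hX, ψ.injective (hY.trans (map_zero ψ).symm)⟩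
  have hdec (z : g) : ∃ a b : k₁, z = ((a : g) + (ψ a : g)) + ((b : g) - (ψ b : g)) := by
    obtain ⟨x, hx, y, hy, rfl⟩ := Submodule.mem_sup.mp
      (hcompl₁₂.sup_eq_top ▸ Submodule.mem_top : z ∈ (k₁ : Submodule ℝ g) ⊔ k₂)
    obtain ⟨Y, hY⟩ := ψ.surjective ⟨y, hy⟩
    obtain rfl : (ψ Y : g) = y := congrArg Subtype.val hY
    refine ⟨(1 / 2 : ℝ) • (⟨x, hx⟩ + Y), (1 / 2 : ℝ) • (⟨x, hx⟩ - Y), ?_⟩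
    simp only [hsmul, hadd, hsub, LieSubmodule.coe_smul, LieSubmodule.coe_add, LieSubmodule.coe_sub]
    module
  have hinj {a b : k₁} (hab : ((a : g) + (ψ a : g)) + ((b : g) - (ψ b : g)) = 0) :
      a = 0 ∧ b = 0 := by
    obtain ⟨hs, hd⟩ := hzero (X := a + b) (Y := a - b) (by
      rw [hsub, LieSubmodule.coe_add, ← hab]; abel)
    obtain rfl := sub_eq_zero.mp hd
    rw [← two_smul ℝ a, smul_eq_zero_iff_right two_ne_zero] at hs
    exact ⟨hs, hs⟩
  have hcompl : IsCompl k p := by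
    refine ⟨Submodule.disjoint_def.mpr fun z hzk hzp => ?_,
      codisjoint_iff.mpr (eq_top_iff.mpr fun z _ => ?_)⟩
    · obtain ⟨X, rfl⟩ := (hmk _).mp hzk
      obtain ⟨Y, hY⟩ := (hmp _).mp (p.neg_mem hzp)
      rw [(hinj (a := X) (b := Y) (by rw [← hY, add_neg_cancel])).1]
      simp
    · obtain ⟨a, b, rfl⟩ := hdec z
      exact Submodule.add_mem_sup ((hmk _).mpr ⟨a, rfl⟩) ((hmp _).mpr ⟨b, rfl⟩)
  refine ⟨?_, hcompl, fun ab => ((ab.1 : g) + (ψ ab.1 : g)) + ((ab.2 : g) - (ψ ab.2 : g)),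
    fun _ => rfl, ⟨fun x y hxy => ?_, fun z => ?_⟩, fun x y => ?_, fun c x => ?_,
    fun a b a' b' => ?_⟩
  · rintro X hX Y hY
    obtain ⟨X, rfl⟩ := (hmk _).mp hX
    obtain ⟨Y, rfl⟩ := (hmk _).mp hY
    exact (hmk _).mpr ⟨⁅X, Y⁆, hkk X Y⟩
  · obtain ⟨h₁, h₂⟩ := hinj (a := x.1 - y.1) (b := x.2 - y.2) (by
      rw [hsub, hsub, LieSubmodule.coe_sub, LieSubmodule.coe_sub, ← sub_eq_zero.mpr hxy]
      dsimp only
      abel)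
    exact Prod.ext (sub_eq_zero.mp h₁) (sub_eq_zero.mp h₂)
  · obtain ⟨a, b, rfl⟩ := hdec z
    exact ⟨(a, b), rfl⟩
  · simp only [Prod.fst_add, Prod.snd_add, hadd, LieSubmodule.coe_add]
    abel
  · simp only [Prod.smul_fst, Prod.smul_snd, hsmul, LieSubmodule.coe_smul, smul_add, smul_sub]
  · rw [contractedBracket_add_add hcompl ((hmk _).mpr ⟨a, rfl⟩) ((hmp _).mpr ⟨b, rfl⟩)
      ((hmk _).mpr ⟨a', rfl⟩) ((hmp _).mpr ⟨b', rfl⟩)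
      ((hmp _).mpr ⟨_, hkp a b'⟩) ((hmp _).mpr ⟨_, hpk b a'⟩), hkk, hkp, hpk]
    simp only [hadd, LieSubmodule.coe_add]
    abel
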